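/- arXiv:1008.4510 — 3 statements merged into one kernel-verified Lean document; each statement's English description precedes it below -/
import Mathlib

section
/- Let n ≥ 1, k ∈ ℕ, N ∈ ℕ. Let f : ℝⁿ → ℂ be of class C^k such that for every multi-index α with |α| ≤ k there is a constant C_α with |∂^α f(x)| ≤ C_α (1+|x|)^{-N} for all x. Let g : ℝⁿ → ℂ be measurable, have vanishing moments of order k, and have decay order N+k+n+1. Then there exists a constant C > 0 (depending only on f and g) such that for all x ∈ ℝⁿ and all t with 0 < t < 1 one has |(g ∗ D_t f)(x)| ≤ C · t^{k+n} · (1+t|x|)^{-N}. -/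
open MeasureTheory SchwartzMap Filter Topology FourierTransform
open scoped ENNReal ContDiff

noncomputable section

/-- Euclidean space ℝⁿ. -/
abbrev Euc (n : ℕ) := EuclideanSpace ℝ (Fin n)

/-- Convolution of two functions on ℝⁿ: (f ∗ g)(x) = ∫ f(y) g(x − y) dy. -/
def conv {n : ℕ} (f g : Euc n → ℂ) : Euc n → ℂ := fun x => ∫ y, f y * g (x - y)

/-- L¹-normalized dilation: (D_t f)(x) = tⁿ f(t x). -/
def dil (n : ℕ) (t : ℝ) (f : Euc n → ℂ) : Euc n → ℂ := fun x => (t ^ n : ℝ) • f (t • x)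

/-- f^*(x) = conj (f (−x)). -/
def starF {n : ℕ} (f : Euc n → ℂ) : Euc n → ℂ := fun x => (starRingEnd ℂ) (f (-x))

/-- The monomial x ↦ x^α for a multi-index α. -/
def monom {n : ℕ} (α : Fin n → ℕ) (x : Euc n) : ℂ := ∏ i, (x i : ℂ) ^ α i

/-- f has vanishing moments of order k: ∫ f(x) x^α dx = 0 (converging absolutely)
for all multi-indices α with |α| ≤ k − 1, i.e. |α| < k. -/
def HasVanishingMoments {n : ℕ} (k : ℕ) (f : Euc n → ℂ) : Prop :=
  ∀ α : Fin n → ℕ, (∑ i, α i) < k →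
    Integrable (fun x => f x * monom α x) ∧ (∫ x, f x * monom α x) = 0

/-- All moments of f vanish (with absolute convergence of all the integrals). -/
def AllMomentsVanish {n : ℕ} (f : Euc n → ℂ) : Prop :=
  ∀ α : Fin n → ℕ,
    Integrable (fun x => f x * monom α x) ∧ (∫ x, f x * monom α x) = 0

/-- f has decay order N: |f(x)| ≤ C (1 + |x|)^{−N}. -/
def HasDecayOrder {n : ℕ} (N : ℕ) (f : Euc n → ℂ) : Prop :=
  ∃ C : ℝ, ∀ x, ‖f x‖ ≤ C / (1 + ‖x‖) ^ N

/-- Partial derivative in the i-th coordinate direction. -/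
def pd {n : ℕ} (i : Fin n) (f : Euc n → ℂ) : Euc n → ℂ :=
  fun x => fderiv ℝ f x (EuclideanSpace.single i (1 : ℝ))

/-- Iterated partial derivative ∂^α along a multi-index α. -/
def mderiv {n : ℕ} (α : Fin n → ℕ) (f : Euc n → ℂ) : Euc n → ℂ :=
  (List.finRange n).foldr (fun i g => (pd i)^[α i] g) f

/-- Schwartz-type seminorm (valued in [0,∞]): sup over x of (1+|x|)^k ‖D^m f(x)‖. -/
def schwartzSemi {n : ℕ} (k m : ℕ) (f : Euc n → ℂ) : ℝ≥0∞ :=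
  ⨆ x, ENNReal.ofReal ((1 + ‖x‖) ^ k * ‖iteratedFDeriv ℝ m f x‖)

/-- Convergence in the topology of the Schwartz space, along a filter `l`:
all Schwartz seminorms of the difference tend to 0. -/
def TendstoSchwartz {n : ℕ} {ι : Type*} (l : Filter ι) (F : ι → Euc n → ℂ)
    (f : Euc n → ℂ) : Prop :=
  ∀ k m : ℕ, Tendsto (fun N => schwartzSemi k m (fun x => F N x - f x)) l (nhds 0)

/-- A pair (ψ, η) of Schwartz functions is LP-admissible: for every Schwartz function f
with all moments vanishing, ∑_{|j| ≤ N} f ∗ ψ_j^* ∗ η_j → f in the Schwartz topology. -/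
def LPAdmissible {n : ℕ} (ψ η : 𝓢(Euc n, ℂ)) : Prop :=
  ∀ f : 𝓢(Euc n, ℂ), AllMomentsVanish (⇑f) →
    TendstoSchwartz atTop
      (fun N : ℕ => fun x => ∑ j ∈ Finset.Icc (-(N : ℤ)) (N : ℤ),
        conv (conv (⇑f) (starF (dil n ((2:ℝ) ^ j) (⇑ψ)))) (dil n ((2:ℝ) ^ j) (⇑η)) x)
      (⇑f)

/-- A Schwartz function ψ is admissible: for every Schwartz f with all moments vanishing,
∫_ε^A f ∗ D_a(ψ^* ∗ ψ) da/a → f in the Schwartz topology as ε → 0⁺, A → ∞. -/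
def Admissible {n : ℕ} (ψ : 𝓢(Euc n, ℂ)) : Prop :=
  ∀ f : 𝓢(Euc n, ℂ), AllMomentsVanish (⇑f) →
    TendstoSchwartz ((nhdsWithin (0:ℝ) (Set.Ioi 0)) ×ˢ (atTop : Filter ℝ))
      (fun εA : ℝ × ℝ => fun x =>
        ∫ a in Set.Ioc εA.1 εA.2, conv (⇑f) (dil n a (conv (starF ⇑ψ) ⇑ψ)) x / (a : ℂ))
      (⇑f)

lemma ContDiff.pd {n : ℕ} {m : ℕ} {f : Euc n → ℂ} (i : Fin n) (hf : ContDiff ℝ (m + 1 : ℕ) f) :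
    ContDiff ℝ m (pd i f) :=
  (hf.fderiv_right (m := m) (by norm_cast)).clm_apply contDiff_const

lemma ContDiff.foldr_pd {n : ℕ} (l : List (Fin n)) {m : ℕ} {f : Euc n → ℂ}
    (hf : ContDiff ℝ (m + l.length : ℕ) f) : ContDiff ℝ m (l.foldr _root_.pd f) := by
  induction l generalizing m with
  | nil => simpa using hf
  | cons a l ih =>
    refine ContDiff.pd a (ih ?_)
    convert hf using 2
    simp only [List.length_cons]
    ring

/-- Partial derivatives of a `C^2` function commute. -/
lemma pd_comm {n : ℕ} {f : Euc n → ℂ} (hf : ContDiff ℝ 2 f) (i j : Fin n) :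
    pd i (pd j f) = pd j (pd i f) := by
  have hd : Differentiable ℝ (fderiv ℝ f) :=
    (hf.fderiv_right (m := 1) (by norm_num)).differentiable one_ne_zero
  have key : ∀ (a b : Fin n) (x : Euc n), pd a (pd b f) x =
      fderiv ℝ (fderiv ℝ f) x (EuclideanSpace.single a 1) (EuclideanSpace.single b 1) := by
    intro a b x
    unfold pd
    rw [fderiv_clm_apply (hd x) (differentiableAt_const _)]
    simp
  funext x
  rw [key, key]
  exact (hf.contDiffAt.isSymmSndFDerivAt (by simp)) _ _

lemma foldr_pd_perm {n : ℕ} {l l' : List (Fin n)} (h : l.Perm l') {f : Euc n → ℂ}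
    (hf : ContDiff ℝ l.length f) : l.foldr pd f = l'.foldr pd f := by
  induction h with
  | nil => rfl
  | cons a _ ih =>
    simp only [List.foldr_cons]
    rw [ih (hf.of_le (by simp))]
  | swap a b l =>
    simp only [List.foldr_cons]
    refine pd_comm (ContDiff.foldr_pd l (m := 2) ?_) _ _
    convert hf using 2
    simp only [List.length_cons]
    ring
  | trans h₁ _ ih₁ ih₂ => exact (ih₁ hf).trans (ih₂ (h₁.length_eq ▸ hf))

lemma iteratedFDeriv_single_eq_foldr_pd {n j : ℕ} {f : Euc n → ℂ} (hf : ContDiff ℝ j f)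
    (r : Fin j → Fin n) (x : Euc n) :
    iteratedFDeriv ℝ j f x (fun i => EuclideanSpace.single (r i) 1) =
      (List.ofFn r).foldr pd f x := by
  induction j generalizing x with
  | zero => simp
  | succ j ih =>
    have hd : Differentiable ℝ (iteratedFDeriv ℝ j f) :=
      hf.differentiable_iteratedFDeriv (by norm_cast; exact j.lt_succ_self)
    rw [(hd x).iteratedFDeriv_succ_apply_left', List.ofFn_succ, List.foldr_cons, pd]
    congr 2
    funext y
    exact ih (hf.of_le (by norm_cast; exact j.le_succ)) (fun i => r i.succ) y

lemma mderiv_eq_foldr_pd {n : ℕ} (α : Fin n → ℕ) (f : Euc n → ℂ) :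
    mderiv α f = ((List.finRange n).flatMap fun i => List.replicate (α i) i).foldr pd f := by
  have hrep : ∀ (m : ℕ) (i : Fin n) (g : Euc n → ℂ),
      (List.replicate m i).foldr pd g = (pd i)^[m] g := by
    intro m i g
    induction m with
    | zero => rfl
    | succ m ih => rw [List.replicate_succ, List.foldr_cons, ih, Function.iterate_succ_apply']
  unfold mderiv
  induction List.finRange n with
  | nil => rfl
  | cons a l ih => rw [List.foldr_cons, List.flatMap_cons, List.foldr_append, hrep, ih]

lemma iteratedFDeriv_single_eq_mderiv {n j : ℕ} {f : Euc n → ℂ} (hf : ContDiff ℝ j f)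
    (r : Fin j → Fin n) (x : Euc n) :
    iteratedFDeriv ℝ j f x (fun i => EuclideanSpace.single (r i) 1) =
      mderiv (fun i => (List.ofFn r).count i) f x := by
  rw [iteratedFDeriv_single_eq_foldr_pd hf, mderiv_eq_foldr_pd]
  refine congrFun (foldr_pd_perm (List.perm_iff_count.2 fun i => ?_) (by simpa using hf)) x
  rw [List.count_flatMap, ← List.ofFn_eq_map, List.sum_ofFn]
  simp [List.count_replicate]

lemma sum_count_ofFn {n j : ℕ} (r : Fin j → Fin n) : ∑ i, (List.ofFn r).count i = j := by
  simpa using Multiset.sum_count_eq_card (s := Finset.univ) (m := (List.ofFn r : Multiset (Fin n)))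
    (by simp)

lemma prod_apply_eq_monom {n j : ℕ} (r : Fin j → Fin n) (x : Euc n) :
    ((∏ i, x (r i) : ℝ) : ℂ) = monom (fun i => (List.ofFn r).count i) x := by
  have := Finset.prod_list_map_count (List.ofFn r) (fun i => (x i : ℂ))
  rw [List.map_ofFn, List.prod_ofFn] at this
  rw [monom, Complex.ofReal_prod]
  refine this.trans (Finset.prod_subset (Finset.subset_univ _) fun i _ hi => ?_)
  rw [List.mem_toFinset] at hi
  rw [List.count_eq_zero_of_not_mem hi, pow_zero]

/-- The `j`-th differential on the diagonal, expanded in monomials. -/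
lemma iteratedFDeriv_diag_eq_sum {n j : ℕ} {f : Euc n → ℂ} (hf : ContDiff ℝ j f) (x v : Euc n) :
    iteratedFDeriv ℝ j f x (fun _ => v) =
      ∑ r : Fin j → Fin n, monom (fun i => (List.ofFn r).count i) v *
        mderiv (fun i => (List.ofFn r).count i) f x := by
  have hv : v = ∑ i, v i • EuclideanSpace.single i (1 : ℝ) := by
    simpa using ((EuclideanSpace.basisFun (Fin n) ℝ).sum_repr v).symm
  conv_lhs => rw [hv]
  rw [ContinuousMultilinearMap.map_sum]
  refine Finset.sum_congr rfl fun r _ => ?_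
  rw [ContinuousMultilinearMap.map_smul_univ, iteratedFDeriv_single_eq_mderiv hf,
    ← prod_apply_eq_monom, Complex.real_smul]

lemma norm_monom_le {n : ℕ} (α : Fin n → ℕ) (x : Euc n) : ‖monom α x‖ ≤ ‖x‖ ^ ∑ i, α i := by
  rw [monom, norm_prod, ← Finset.prod_pow_eq_pow_sum]
  refine Finset.prod_le_prod (fun _ _ => norm_nonneg _) fun i _ => ?_
  rw [norm_pow, Complex.norm_real]
  exact pow_le_pow_left₀ (norm_nonneg _) (PiLp.norm_apply_le x i) _

lemma exists_norm_iteratedFDeriv_diag_le {n k N : ℕ} {f : Euc n → ℂ} (hf : ContDiff ℝ k f)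
    (hf_decay : ∀ α : Fin n → ℕ, (∑ i, α i) ≤ k →
      ∃ Cα : ℝ, ∀ x, ‖mderiv α f x‖ ≤ Cα / (1 + ‖x‖) ^ N) :
    ∃ C : ℝ, 0 ≤ C ∧ ∀ x v, ‖iteratedFDeriv ℝ k f x (fun _ => v)‖ ≤
      C * ‖v‖ ^ k / (1 + ‖x‖) ^ N := by
  have h : ∀ r : Fin k → Fin n, ∃ C : ℝ,
      ∀ x, ‖mderiv (fun i => (List.ofFn r).count i) f x‖ ≤ C / (1 + ‖x‖) ^ N :=
    fun r => hf_decay _ (sum_count_ofFn r).le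
  choose C hC using h
  have hC0 : ∀ r, 0 ≤ C r := fun r => by
    simpa using (norm_nonneg _).trans (hC r 0)
  refine ⟨∑ r, C r, Finset.sum_nonneg fun r _ => hC0 r, fun x v => ?_⟩
  rw [iteratedFDeriv_diag_eq_sum hf, Finset.sum_mul, Finset.sum_div]
  refine norm_sum_le_of_le _ fun r _ => ?_
  rw [norm_mul, mul_comm (C r), mul_div_assoc]
  have := norm_monom_le (fun i => (List.ofFn r).count i) v
  rw [sum_count_ofFn] at this
  exact mul_le_mul this (hC r x) (norm_nonneg _) (by positivity)

lemma HasVanishingMoments.integral_iteratedFDeriv {n k j : ℕ} {f g : Euc n → ℂ}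
    (hg : HasVanishingMoments k g) (hj : j < k) (hf : ContDiff ℝ k f) (x : Euc n) (c : ℝ) :
    Integrable (fun y => g y * iteratedFDeriv ℝ j f x (fun _ => c • y)) ∧
      ∫ y, g y * iteratedFDeriv ℝ j f x (fun _ => c • y) = 0 := by
  have hexp : (fun y => g y * iteratedFDeriv ℝ j f x (fun _ => c • y)) = fun y =>
      ∑ r : Fin j → Fin n, (g y * monom (fun i => (List.ofFn r).count i) y) *
        ((c ^ j : ℝ) * mderiv (fun i => (List.ofFn r).count i) f x) := by
    funext y
    have := (iteratedFDeriv ℝ j f x).map_smul_univ (fun _ => c) (fun _ => y)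
    rw [this, iteratedFDeriv_diag_eq_sum (hf.of_le (by exact_mod_cast hj.le)), Complex.real_smul,
      Finset.mul_sum, Finset.mul_sum]
    refine Finset.sum_congr rfl fun r _ => ?_
    simp only [Finset.prod_const, Finset.card_univ, Fintype.card_fin]
    ring
  have hr := fun r : Fin j → Fin n => hg _ ((sum_count_ofFn r).trans_lt hj)
  rw [hexp]
  refine ⟨integrable_finsetSum _ fun r _ => (hr r).1.mul_const _, ?_⟩
  rw [integral_finsetSum _ fun r _ => (hr r).1.mul_const _]
  exact Finset.sum_eq_zero fun r _ => by rw [integral_mul_const, (hr r).2, zero_mul]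

/-- Taylor's theorem with a bound on the remainder along the segment. -/
lemma norm_sub_taylor_le {E F : Type*} [NormedAddCommGroup E] [NormedSpace ℝ E]
    [NormedAddCommGroup F] [NormedSpace ℝ F] [CompleteSpace F] {k : ℕ} {f : E → F}
    (hf : ContDiff ℝ k f) {a v : E} {B : ℝ}
    (hB : ∀ s ∈ Set.Icc (0 : ℝ) 1, ‖iteratedFDeriv ℝ k f (a + s • v) (fun _ => v)‖ ≤ B) :
    ‖f (a + v) - ∑ j ∈ Finset.range k, (j.factorial : ℝ)⁻¹ • iteratedFDeriv ℝ j f a (fun _ => v)‖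
      ≤ B := by
  cases k with
  | zero => simpa using hB 1 (by simp)
  | succ m =>
    rw [map_add_eq_sum_add_integral_iteratedFDeriv (f := f) (x := a) (y := v) (n := m)
      (fun s _ => by exact_mod_cast hf.contDiffAt), add_sub_cancel_left, norm_smul]
    have hB0 : 0 ≤ B := (norm_nonneg _).trans (hB 0 (by simp))
    have h₁ : ‖∫ s in (0 : ℝ)..1,
        (1 - s) ^ m • iteratedFDeriv ℝ (m + 1) f (a + s • v) (fun _ => v)‖ ≤ B * |1 - 0| := by
      refine intervalIntegral.norm_integral_le_of_norm_le_const fun s hs => ?_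
      rw [Set.uIoc_of_le zero_le_one] at hs
      rw [norm_smul, norm_pow, Real.norm_of_nonneg (by linarith [hs.2])]
      exact (mul_le_mul (pow_le_one₀ (by linarith [hs.2]) (by linarith [hs.1]))
        (hB s ⟨hs.1.le, hs.2⟩) (norm_nonneg _) zero_le_one).trans_eq (one_mul B)
    rw [sub_zero, abs_one, mul_one] at h₁
    have h₂ : ‖((m.factorial : ℝ))⁻¹‖ ≤ 1 := by
      rw [norm_inv, Real.norm_natCast]
      exact inv_le_one_of_one_le₀ (by exact_mod_cast m.factorial_pos)
    exact (mul_le_mul h₂ h₁ (norm_nonneg _) zero_le_one).trans_eq (one_mul B)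

/-- Peetre's inequality. -/
lemma one_add_norm_le_mul {E : Type*} [SeminormedAddCommGroup E] (a b : E) :
    1 + ‖a‖ ≤ (1 + ‖a + b‖) * (1 + ‖b‖) := by
  have : ‖a‖ ≤ ‖a + b‖ + ‖b‖ := by simpa using norm_sub_le (a + b) b
  nlinarith [norm_nonneg (a + b), norm_nonneg b]

/-- Lemma 3.12(a) of the paper (pointwise estimate), for G = ℝⁿ: if f ∈ C^k has all partial
derivatives of order ≤ k of decay order N, and g has vanishing moments of order k and decay
order N + k + n + 1, then |(g ∗ D_t f)(x)| ≤ C t^{k+n} (1 + t|x|)^{−N} for 0 < t < 1. -/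
theorem statement0 (n : ℕ) (hn : 1 ≤ n) (k N : ℕ) (f g : Euc n → ℂ)
    (hf_smooth : ContDiff ℝ k f)
    (hf_decay : ∀ α : Fin n → ℕ, (∑ i, α i) ≤ k →
      ∃ Cα : ℝ, ∀ x, ‖mderiv α f x‖ ≤ Cα / (1 + ‖x‖) ^ N)
    (hg_meas : Measurable g)
    (hg_mom : HasVanishingMoments k g)
    (hg_decay : HasDecayOrder (N + k + n + 1) g) :
    ∃ C : ℝ, 0 < C ∧ ∀ (x : Euc n) (t : ℝ), 0 < t → t < 1 →
      ‖conv g (dil n t f) x‖ ≤ C * t ^ (k + n) / (1 + t * ‖x‖) ^ N := by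
  obtain ⟨A, hA0, hA⟩ := exists_norm_iteratedFDeriv_diag_le hf_smooth hf_decay
  obtain ⟨B, hB⟩ := hg_decay
  have hB0 : 0 ≤ B := by simpa using (norm_nonneg _).trans (hB 0)
  have hint : Integrable fun y : Euc n => ((1 + ‖y‖) ^ (n + 1))⁻¹ := by
    have h := integrable_one_add_norm (E := Euc n) (μ := volume) (r := (n + 1 : ℕ)) (by simp)
    refine h.congr (Eventually.of_forall fun y => ?_)
    simp only
    rw [Real.rpow_neg (by positivity), Real.rpow_natCast]
  set I := ∫ y : Euc n, ((1 + ‖y‖) ^ (n + 1))⁻¹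
  have hI : 0 ≤ I := integral_nonneg fun y => by positivity
  refine ⟨A * B * I + 1, by positivity, fun x t ht ht1 => ?_⟩
  set P : Euc n → ℂ := fun y => ∑ j ∈ Finset.range k,
    (j.factorial : ℝ)⁻¹ • iteratedFDeriv ℝ j f (t • x) (fun _ => (-t) • y) with hP
  have hgP : Integrable (fun y => g y * P y) ∧ ∫ y, g y * P y = 0 := by
    have hj := fun j (hj : j ∈ Finset.range k) =>
      hg_mom.integral_iteratedFDeriv (Finset.mem_range.1 hj) hf_smooth (t • x) (-t)
    have hexp : (fun y => g y * P y) = fun y => ∑ j ∈ Finset.range k, (j.factorial : ℝ)⁻¹ •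
        (g y * iteratedFDeriv ℝ j f (t • x) (fun _ => (-t) • y)) := by
      funext y
      simp only [hP, Finset.mul_sum, mul_smul_comm]
    rw [hexp]
    have hs := fun j h => (hj j h).1.smul (j.factorial : ℝ)⁻¹
    refine ⟨integrable_finsetSum _ hs, (integral_finsetSum _ hs).trans ?_⟩
    exact Finset.sum_eq_zero fun j h =>
      (integral_smul (j.factorial : ℝ)⁻¹ _).trans (by rw [(hj j h).2, smul_zero])
  set D := (1 + t * ‖x‖) ^ N
  have hD : 0 < D := by positivity
  have hbound : ∀ y, ‖g y * f (t • (x - y)) - g y * P y‖ ≤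
      A * B * t ^ k / D * ((1 + ‖y‖) ^ (n + 1))⁻¹ := by
    intro y
    have hT : ‖f (t • x + (-t) • y) - P y‖ ≤ A * (t * ‖y‖) ^ k * ((1 + ‖y‖) ^ N / D) := by
      refine norm_sub_taylor_le hf_smooth fun s hs => (hA _ _).trans ?_
      rw [norm_smul, norm_neg, Real.norm_of_nonneg ht.le]
      have hw : 1 + t * ‖x‖ ≤ (1 + ‖t • x + s • (-t) • y‖) * (1 + ‖y‖) := by
        have h₁ := one_add_norm_le_mul (t • x) (s • (-t) • y)
        have h₂ : ‖s • (-t) • y‖ ≤ ‖y‖ := by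
          rw [norm_smul, norm_smul, norm_neg, Real.norm_of_nonneg ht.le,
            Real.norm_of_nonneg hs.1, ← mul_assoc]
          exact mul_le_of_le_one_left (norm_nonneg _) (mul_le_one₀ hs.2 ht.le ht1.le)
        rw [norm_smul, Real.norm_of_nonneg ht.le] at h₁
        refine h₁.trans ?_
        gcongr
      rw [div_eq_mul_one_div]
      gcongr ?_ * ?_
      rw [div_le_div_iff₀ (by positivity) hD, one_mul, mul_comm, ← mul_pow]
      exact pow_le_pow_left₀ (by positivity) hw N
    have hx : t • (x - y) = t • x + (-t) • y := by rw [smul_sub, neg_smul, sub_eq_add_neg]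
    rw [hx, ← mul_sub, norm_mul]
    refine (mul_le_mul (hB y) hT (norm_nonneg _) (by positivity)).trans ?_
    calc B / (1 + ‖y‖) ^ (N + k + n + 1) * (A * (t * ‖y‖) ^ k * ((1 + ‖y‖) ^ N / D))
        ≤ B / (1 + ‖y‖) ^ (N + k + n + 1) * (A * (t * (1 + ‖y‖)) ^ k * ((1 + ‖y‖) ^ N / D)) := by
          gcongr
          linarith
      _ = _ := by
          rw [mul_pow]
          field_simp
          ring
  have hmeas : AEStronglyMeasurable (fun y => g y * f (t • (x - y))) volume :=
    hg_meas.aestronglyMeasurable.mul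
      (hf_smooth.continuous.comp
        (by fun_prop : Continuous fun y => t • (x - y))).aestronglyMeasurable
  have hdiff : Integrable fun y => g y * f (t • (x - y)) - g y * P y :=
    (hint.const_mul _).mono' (hmeas.sub hgP.1.aestronglyMeasurable) (Eventually.of_forall hbound)
  have hconv : conv g (dil n t f) x =
      (t ^ n : ℝ) • ∫ y, (g y * f (t • (x - y)) - g y * P y) := by
    have hsum : ∫ y, g y * f (t • (x - y)) = ∫ y, (g y * f (t • (x - y)) - g y * P y) := by
      have := integral_add hdiff hgP.1
      simpa [hgP.2] using this
    rw [← hsum, ← integral_smul]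
    simp only [conv, dil, mul_smul_comm]
  have hmain := norm_integral_le_of_norm_le (hint.const_mul _) (Eventually.of_forall hbound)
  rw [integral_const_mul] at hmain
  rw [hconv, norm_smul, Real.norm_of_nonneg (by positivity)]
  calc t ^ n * _ ≤ t ^ n * (A * B * t ^ k / D * I) := by gcongr
    _ = A * B * I * t ^ (k + n) / D := by ring
    _ ≤ (A * B * I + 1) * t ^ (k + n) / D := by
        gcongr
        linarith

end
end

section
/- Let n ≥ 1 and k ≥ 1. Let ψ, η be Schwartz functions on ℝⁿ, each having vanishing moments of order k. Then there exists a constant C > 0 such that for all j, ℓ ∈ ℤ one has ‖η_j ∗ (ψ_ℓ)^*‖_{L¹(ℝⁿ)} ≤ C · 2^{-|j-ℓ|·k}, where η_j = D_{2^j} η and ψ_ℓ = D_{2^ℓ} ψ. -/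
open MeasureTheory SchwartzMap Filter Topology FourierTransform
open scoped ENNReal ContDiff

noncomputable section

/-- Vanishing moments annihilate every homogeneous polynomial of degree `m < k`. -/
theorem HasVanishingMoments.integral_mul_multilinear {n k m : ℕ} {f : Euc n → ℂ}
    (hf : HasVanishingMoments k f) (hm : m < k)
    (M : ContinuousMultilinearMap ℝ (fun _ : Fin m => Euc n) ℂ) :
    Integrable (fun y => f y * M fun _ => y) ∧ ∫ y, f y * M (fun _ => y) = 0 := by
  classical
  let α : (Fin m → Fin n) → Fin n → ℕ := fun s c => (Finset.univ.filter fun l => s l = c).card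
  have hα : ∀ s, ∑ c, α s c < k := by
    intro s
    rw [← Finset.card_eq_sum_card_fiberwise (by simp)]
    simpa using hm
  have hexp : ∀ y : Euc n, f y * M (fun _ => y) =
      ∑ s : Fin m → Fin n, (f y * monom (α s) y) *
        M (fun l => EuclideanSpace.basisFun (Fin n) ℝ (s l)) := by
    intro y
    have hy : y = ∑ c, y c • EuclideanSpace.basisFun (Fin n) ℝ c := by
      simpa using ((EuclideanSpace.basisFun (Fin n) ℝ).sum_repr y).symm
    conv_lhs => rw [hy]
    rw [M.map_sum, ← hy, Finset.mul_sum]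
    refine Finset.sum_congr rfl fun s _ => ?_
    rw [M.map_smul_univ (fun l => y (s l)), mul_assoc, Complex.real_smul]
    congr 2
    rw [monom, Complex.ofReal_prod, ← Finset.prod_fiberwise' Finset.univ s fun c => (y c : ℂ)]
    simp [α]
  simp_rw [hexp]
  have hint : ∀ s : Fin m → Fin n, Integrable fun y => (f y * monom (α s) y) *
        M (fun l => EuclideanSpace.basisFun (Fin n) ℝ (s l)) :=
    fun s => (hf _ (hα s)).1.mul_const _
  refine ⟨integrable_finsetSum _ fun s _ => hint s, ?_⟩
  rw [integral_finsetSum _ fun s _ => hint s]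
  refine Finset.sum_eq_zero fun s _ => ?_
  rw [integral_mul_const, (hf _ (hα s)).2, zero_mul]

/-- Taylor remainder bound in integral form. -/
theorem enorm_sub_taylor_le {E : Type*} [NormedAddCommGroup E] [NormedSpace ℝ E] {g : E → ℂ}
    {p : ℕ} (hg : ContDiff ℝ (p + 1) g) (x w : E) :
    ‖g (x + w) - ∑ m ∈ Finset.range (p + 1),
        ((m.factorial : ℝ)⁻¹ • iteratedFDeriv ℝ m g x fun _ => w)‖ₑ ≤
      ENNReal.ofReal (‖w‖ ^ (p + 1)) *
        ∫⁻ t in Set.Ioc (0 : ℝ) 1, ‖iteratedFDeriv ℝ (p + 1) g (x + t • w)‖ₑ := by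
  rw [map_add_eq_sum_add_integral_iteratedFDeriv (n := p) fun t _ => hg.contDiffAt,
    add_sub_cancel_left, intervalIntegral.integral_of_le zero_le_one, enorm_smul]
  have h1 : ‖((p.factorial : ℝ)⁻¹)‖ₑ ≤ 1 := by
    rw [← ofReal_norm, ENNReal.ofReal_le_one, norm_inv, Real.norm_natCast]
    exact inv_le_one_of_one_le₀ (by exact_mod_cast p.factorial_pos)
  refine (mul_le_mul' h1 (enorm_integral_le_lintegral_enorm _)).trans ?_
  rw [one_mul, ← lintegral_const_mul' _ _ ENNReal.ofReal_ne_top]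
  refine setLIntegral_mono' measurableSet_Ioc fun t ht => ?_
  rw [← ofReal_norm, ← ofReal_norm, ← ENNReal.ofReal_mul (by positivity)]
  refine ENNReal.ofReal_le_ofReal ?_
  rw [norm_smul, norm_pow]
  have h2 : ‖1 - t‖ ^ p ≤ 1 := by
    refine pow_le_one₀ (norm_nonneg _) ?_
    rw [Real.norm_eq_abs, abs_le]
    constructor <;> linarith [ht.1, ht.2]
  have h3 := (iteratedFDeriv ℝ (p + 1) g (x + t • w)).le_opNorm fun _ => w
  simp only [Finset.prod_const, Finset.card_univ, Fintype.card_fin] at h3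
  calc _ ≤ 1 * (‖iteratedFDeriv ℝ (p + 1) g (x + t • w)‖ * ‖w‖ ^ (p + 1)) := by gcongr
    _ = _ := by ring

/-- Cancellation of `f` against the Taylor polynomial of `g`. -/
theorem enorm_integral_mul_comp_sub_smul_le {n p : ℕ} {f g : 𝓢(Euc n, ℂ)}
    (hf : HasVanishingMoments (p + 1) f) (r : ℝ) (x : Euc n) :
    ‖∫ y, f y * g (x - r • y)‖ₑ ≤
      ∫⁻ y, ‖f y‖ₑ * (ENNReal.ofReal (‖(-r) • y‖ ^ (p + 1)) *
        ∫⁻ t in Set.Ioc (0 : ℝ) 1, ‖iteratedFDeriv ℝ (p + 1) g (x + t • (-r) • y)‖ₑ) := by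
  let M : (m : ℕ) → ContinuousMultilinearMap ℝ (fun _ : Fin m => Euc n) ℂ := fun m =>
    ((m.factorial : ℝ)⁻¹ * (-r) ^ m) • iteratedFDeriv ℝ m g x
  have hM : ∀ m y, M m (fun _ => y) =
      (m.factorial : ℝ)⁻¹ • iteratedFDeriv ℝ m g x fun _ => (-r) • y := by
    intro m y
    have := (iteratedFDeriv ℝ m g x).map_smul_univ (fun _ => -r) fun _ => y
    simp only [Finset.prod_const, Finset.card_univ, Fintype.card_fin] at this
    rw [this, smul_smul]
    rfl
  have hmom := fun m (hm : m ∈ Finset.range (p + 1)) =>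
    hf.integral_mul_multilinear (Finset.mem_range.1 hm) (M m)
  have hfg : Integrable fun y => f y * g (x - r • y) := by
    refine f.integrable.mul_bdd (c := SchwartzMap.seminorm ℝ 0 0 g) ?_ ?_
    · have := g.continuous
      exact Continuous.aestronglyMeasurable (by fun_prop)
    · exact .of_forall fun y => norm_le_seminorm ℝ g _
  have hsub : ∫ y, f y * g (x - r • y) =
      ∫ y, f y * (g (x + (-r) • y) - ∑ m ∈ Finset.range (p + 1),
        ((m.factorial : ℝ)⁻¹ • iteratedFDeriv ℝ m g x fun _ => (-r) • y)) := by
    simp_rw [← hM, mul_sub, Finset.mul_sum, neg_smul, ← sub_eq_add_neg]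
    rw [integral_sub hfg (integrable_finsetSum _ fun m hm => (hmom m hm).1),
      integral_finsetSum _ fun m hm => (hmom m hm).1,
      Finset.sum_eq_zero fun m hm => (hmom m hm).2, sub_zero]
  rw [hsub]
  refine (enorm_integral_le_lintegral_enorm _).trans (lintegral_mono fun y => ?_)
  rw [enorm_mul]
  gcongr
  exact enorm_sub_taylor_le (mod_cast g.smooth ((p + 1 : ℕ) : ℕ∞)) x _

/-- L¹ bound for the normalized convolution at relative scale `r`. -/
theorem lintegral_enorm_integral_mul_comp_sub_smul_le {n p : ℕ} {f g : 𝓢(Euc n, ℂ)}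
    (hf : HasVanishingMoments (p + 1) f) {r : ℝ} (hr : 0 ≤ r) :
    ∫⁻ x, ‖∫ y, f y * g (x - r • y)‖ₑ ≤
      ENNReal.ofReal (r ^ (p + 1)) * ((∫⁻ y, ‖f y‖ₑ * ENNReal.ofReal (‖y‖ ^ (p + 1))) *
        ∫⁻ x, ‖iteratedFDeriv ℝ (p + 1) g x‖ₑ) := by
  have hD : Continuous (iteratedFDeriv ℝ (p + 1) g) :=
    (g.smooth ((p + 1 : ℕ) : ℕ∞)).continuous_iteratedFDeriv (mod_cast le_rfl)
  have hfc := f.continuous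
  have hmeas : Measurable fun q : Euc n × Euc n =>
      ∫⁻ t in Set.Ioc (0 : ℝ) 1, ‖iteratedFDeriv ℝ (p + 1) g (q.1 + t • (-r) • q.2)‖ₑ := by
    refine Measurable.lintegral_prod_right' (ν := volume.restrict (Set.Ioc (0 : ℝ) 1))
      (f := fun q : (Euc n × Euc n) × ℝ =>
        ‖iteratedFDeriv ℝ (p + 1) g (q.1.1 + q.2 • (-r) • q.1.2)‖ₑ) ?_
    exact Continuous.measurable (by fun_prop)
  calc ∫⁻ x, ‖∫ y, f y * g (x - r • y)‖ₑ
      ≤ ∫⁻ x, ∫⁻ y, ‖f y‖ₑ * (ENNReal.ofReal (‖(-r) • y‖ ^ (p + 1)) *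
        ∫⁻ t in Set.Ioc (0 : ℝ) 1, ‖iteratedFDeriv ℝ (p + 1) g (x + t • (-r) • y)‖ₑ) :=
        lintegral_mono fun x => enorm_integral_mul_comp_sub_smul_le hf r x
    _ = ∫⁻ y, ∫⁻ x, ‖f y‖ₑ * (ENNReal.ofReal (‖(-r) • y‖ ^ (p + 1)) *
        ∫⁻ t in Set.Ioc (0 : ℝ) 1, ‖iteratedFDeriv ℝ (p + 1) g (x + t • (-r) • y)‖ₑ) := by
        refine lintegral_lintegral_swap (Measurable.aemeasurable ?_)
        exact Measurable.mul (Continuous.measurable (by fun_prop))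
          (Measurable.mul (Continuous.measurable (by fun_prop)).ennreal_ofReal hmeas)
    _ = ∫⁻ y, ENNReal.ofReal (r ^ (p + 1)) * ((‖f y‖ₑ * ENNReal.ofReal (‖y‖ ^ (p + 1))) *
        ∫⁻ x, ‖iteratedFDeriv ℝ (p + 1) g x‖ₑ) := by
        refine lintegral_congr fun y => ?_
        rw [lintegral_const_mul' _ _ enorm_ne_top, lintegral_const_mul' _ _ ENNReal.ofReal_ne_top,
          lintegral_lintegral_swap]
        · simp_rw [lintegral_add_right_eq_self (fun x => ‖iteratedFDeriv ℝ (p + 1) g x‖ₑ)]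
          rw [norm_smul, norm_neg, Real.norm_of_nonneg hr, mul_pow,
            ENNReal.ofReal_mul (by positivity)]
          simp only [lintegral_const, MeasurableSet.univ, Measure.restrict_apply, Set.univ_inter,
            Real.volume_Ioc, sub_zero, ENNReal.ofReal_one, mul_one]
          ring
        · exact (Continuous.measurable (by fun_prop)).aemeasurable
    _ = _ := by
        rw [lintegral_const_mul' _ _ ENNReal.ofReal_ne_top, lintegral_mul_const]
        exact hfc.enorm.measurable.mul (Continuous.measurable (by fun_prop)).ennreal_ofReal

theorem ofReal_pow_mul_lintegral_comp_smul {n : ℕ} {b : ℝ} (hb : 0 < b) (F : Euc n → ℝ≥0∞) :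
    ENNReal.ofReal (b ^ n) * ∫⁻ x, F (b • x) = ∫⁻ x, F x := by
  have h := lintegral_map_equiv (μ := volume) F
    (Homeomorph.smulOfNeZero (α := Euc n) b hb.ne').toMeasurableEquiv
  have h2 := Measure.map_addHaar_smul (volume : Measure (Euc n)) hb.ne'
  change ∫⁻ x, F x ∂(Measure.map (fun x => b • x) volume) = ∫⁻ x, F (b • x) at h
  rw [← h, h2, lintegral_smul_measure, smul_eq_mul, ← mul_assoc,
    ← ENNReal.ofReal_mul (by positivity), abs_of_pos (by positivity)]
  simp [hb.ne']

theorem conv_dil_dil {n : ℕ} {a b : ℝ} (ha : 0 < a) (f g : Euc n → ℂ) (x : Euc n) :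
    conv (dil n a f) (dil n b g) x = (b ^ n : ℝ) • ∫ y, f y * g (b • x - (b / a) • y) := by
  have h := Measure.integral_comp_smul volume (fun y => f y * g (b • x - (b / a) • y)) a
  rw [finrank_euclideanSpace_fin, abs_of_pos (by positivity), eq_inv_smul_iff₀ (by positivity)] at h
  rw [← h, ← integral_smul, ← integral_smul, conv]
  refine integral_congr_ae (.of_forall fun y => ?_)
  simp only [dil, smul_smul, div_mul_cancel₀ _ ha.ne', smul_sub, Complex.real_smul]
  push_cast
  ring

theorem conv_comm {n : ℕ} (f g : Euc n → ℂ) : conv f g = conv g f := by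
  ext x
  rw [conv, conv, ← integral_sub_left_eq_self _ volume x]
  simp [mul_comm]

/-- Cross-scale estimate using only the cancellation of `f`. -/
theorem exists_eLpNorm_conv_dil_le {n k : ℕ} (hk : 1 ≤ k) (f g : 𝓢(Euc n, ℂ))
    (hf : HasVanishingMoments k f) :
    ∃ C : ℝ, 0 ≤ C ∧ ∀ a b : ℝ, 0 < a → 0 < b →
      eLpNorm (conv (dil n a f) (dil n b g)) 1 volume ≤ ENNReal.ofReal (C * (b / a) ^ k) := by
  obtain ⟨p, rfl⟩ := Nat.exists_eq_add_of_le' hk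
  set K := (∫⁻ y, ‖f y‖ₑ * ENNReal.ofReal (‖y‖ ^ (p + 1))) *
    ∫⁻ x, ‖iteratedFDeriv ℝ (p + 1) g x‖ₑ with hK
  have hKtop : K ≠ ⊤ := by
    refine ENNReal.mul_ne_top ?_ ?_
    · have h := (f.integrable_pow_mul volume (p + 1)).lintegral_lt_top.ne
      convert h using 3 with y
      rw [mul_comm, ENNReal.ofReal_mul (by positivity), ofReal_norm]
    · have h := (g.integrable_pow_mul_iteratedFDeriv volume 0 (p + 1)).lintegral_lt_top.ne
      simpa only [pow_zero, one_mul, ofReal_norm] using h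
  refine ⟨K.toReal, ENNReal.toReal_nonneg, fun a b ha hb => ?_⟩
  rw [eLpNorm_one_eq_lintegral_enorm]
  calc ∫⁻ x, ‖conv (dil n a f) (dil n b g) x‖ₑ
      = ENNReal.ofReal (b ^ n) * ∫⁻ x, ‖∫ y, f y * g (b • x - (b / a) • y)‖ₑ := by
        rw [← lintegral_const_mul' _ _ ENNReal.ofReal_ne_top]
        refine lintegral_congr fun x => ?_
        rw [conv_dil_dil ha, enorm_smul, Real.enorm_of_nonneg (by positivity)]
    _ = ∫⁻ x, ‖∫ y, f y * g (x - (b / a) • y)‖ₑ :=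
        ofReal_pow_mul_lintegral_comp_smul hb fun x => ‖∫ y, f y * g (x - (b / a) • y)‖ₑ
    _ ≤ ENNReal.ofReal ((b / a) ^ (p + 1)) * K :=
        lintegral_enorm_integral_mul_comp_sub_smul_le hf (by positivity)
    _ = _ := by
        rw [mul_comm K.toReal, ENNReal.ofReal_mul (by positivity), ENNReal.ofReal_toReal hKtop]

theorem starF_dil {n : ℕ} (t : ℝ) (f : Euc n → ℂ) : starF (dil n t f) = dil n t (starF f) := by
  ext x
  simp [starF, dil]

/-- The Schwartz function `f^*`. -/
def starSchwartz {n : ℕ} (f : 𝓢(Euc n, ℂ)) : 𝓢(Euc n, ℂ) :=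
  (compCLMOfContinuousLinearEquiv ℝ (ContinuousLinearEquiv.neg ℝ) f).postcompCLM
    (Complex.conjCLE : ℂ →L[ℝ] ℂ)

theorem coe_starSchwartz {n : ℕ} (f : 𝓢(Euc n, ℂ)) : ⇑(starSchwartz f) = starF f := by
  ext x
  simp [starSchwartz, starF, postcompCLM_apply]

theorem HasVanishingMoments.starF {n k : ℕ} {f : Euc n → ℂ} (hf : HasVanishingMoments k f) :
    HasVanishingMoments k (starF f) := by
  intro α hα
  obtain ⟨hi, h0⟩ := hf α hα
  have heq : (fun x => _root_.starF f x * monom α x) =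
      fun x => (-1 : ℂ) ^ (∑ i, α i) * (starRingEnd ℂ) (f (-x) * monom α (-x)) := by
    ext x
    have h1 : (-1 : ℂ) ^ (∑ i, α i) * (-1 : ℂ) ^ (∑ i, α i) = 1 := by
      rw [← mul_pow]; simp
    have h2 : (starRingEnd ℂ) (monom α (-x)) = (-1 : ℂ) ^ (∑ i, α i) * monom α x := by
      simp only [monom, map_prod, map_pow, PiLp.neg_apply, Complex.ofReal_neg, map_neg,
        Complex.conj_ofReal]
      rw [← Finset.prod_pow_eq_pow_sum, ← Finset.prod_mul_distrib]
      exact Finset.prod_congr rfl fun i _ => neg_pow _ _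
    rw [map_mul, h2, _root_.starF]
    linear_combination (-(starRingEnd ℂ) (f (-x)) * monom α x) * h1
  rw [heq]
  constructor
  · exact (Complex.conjCLE.toContinuousLinearMap.integrable_comp hi.comp_neg).const_mul _
  · rw [integral_const_mul, integral_conj,
      integral_neg_eq_self (fun x => f x * monom α x) volume, h0]
    simp

/-- The cross-scale L¹ estimate from the proofs of Theorems 3.8 and 3.14 of the paper,
for G = ℝⁿ: if ψ, η are Schwartz with vanishing moments of order k ≥ 1, then
‖η_j ∗ ψ_ℓ^*‖₁ ≤ C 2^{−|j−ℓ| k}. -/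
theorem statement3 (n : ℕ) (hn : 1 ≤ n) (k : ℕ) (hk : 1 ≤ k) (ψ η : 𝓢(Euc n, ℂ))
    (hψ : HasVanishingMoments k (⇑ψ)) (hη : HasVanishingMoments k (⇑η)) :
    ∃ C : ℝ, 0 < C ∧ ∀ j ℓ : ℤ,
      eLpNorm (conv (dil n ((2:ℝ) ^ j) (⇑η)) (starF (dil n ((2:ℝ) ^ ℓ) (⇑ψ)))) 1 volume
        ≤ ENNReal.ofReal (C * (2:ℝ) ^ (-((|j - ℓ| : ℤ) : ℝ) * (k : ℝ))) := by
  obtain ⟨C₁, hC₁, h₁⟩ := exists_eLpNorm_conv_dil_le hk η (starSchwartz ψ) hη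
  obtain ⟨C₂, hC₂, h₂⟩ := exists_eLpNorm_conv_dil_le hk (starSchwartz ψ) η
    (by rw [coe_starSchwartz]; exact hψ.starF)
  have hscale : ∀ i m : ℤ, i ≤ m →
      ((2 : ℝ) ^ i / 2 ^ m) ^ k = (2 : ℝ) ^ (-((|m - i| : ℤ) : ℝ) * (k : ℝ)) := by
    intro i m him
    rw [abs_of_nonneg (sub_nonneg.2 him), Real.rpow_mul_natCast zero_le_two, ← Int.cast_neg,
      Real.rpow_intCast, neg_sub, zpow_sub₀ two_ne_zero]
  refine ⟨C₁ + C₂ + 1, by positivity, fun j ℓ => ?_⟩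
  rw [starF_dil, ← coe_starSchwartz]
  rcases le_total ℓ j with h | h
  · refine (h₁ _ _ (by positivity) (by positivity)).trans (ENNReal.ofReal_le_ofReal ?_)
    rw [hscale _ _ h]
    gcongr
    linarith
  · rw [conv_comm]
    refine (h₂ _ _ (by positivity) (by positivity)).trans (ENNReal.ofReal_le_ofReal ?_)
    rw [hscale _ _ h, abs_sub_comm]
    gcongr
    linarith

end
end

section
/- Let ψ be a Schwartz function on ℝ whose Fourier transform ψ̂ is smooth, compactly supported, vanishes identically on the interval (−δ, δ) for some δ > 0, and satisfies ∑_{j∈ℤ} |ψ̂(2^j ξ)|² = 1 for every ξ ≠ 0. Let φ be a Schwartz function on ℝ whose Fourier transform φ̂ is supported in (−δ, δ) and satisfies φ̂(0) ≠ 0, and set η = ψ + φ. Then η^* ∗ ψ = ψ^* ∗ ψ, and consequently the pair (η, ψ) is LP-admissible, i.e. for every Schwartz function f on ℝ with all moments vanishing, ∑_{|j| ≤ N} f ∗ η_j^* ∗ ψ_j → f in the Schwartz topology as N → ∞; yet the zeroth moment ∫_ℝ η(x) dx = φ̂(0) is nonzero. -/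
open MeasureTheory SchwartzMap Filter Topology FourierTransform
open scoped ENNReal ContDiff

noncomputable section

/-- Convolution on ℝ: (f ∗ g)(x) = ∫ f(y) g(x − y) dy. -/
def conv1 (f g : ℝ → ℂ) : ℝ → ℂ := fun x => ∫ y, f y * g (x - y)

/-- L¹-normalized dilation on ℝ: (D_t f)(x) = t f(t x). -/
def dil1 (t : ℝ) (f : ℝ → ℂ) : ℝ → ℂ := fun x => (t : ℝ) • f (t * x)

/-- f^*(x) = conj (f (−x)). -/
def starF1 (f : ℝ → ℂ) : ℝ → ℂ := fun x => (starRingEnd ℂ) (f (-x))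

/-- All moments of f vanish (with absolute convergence of all the integrals). -/
def AllMomentsVanish1 (f : ℝ → ℂ) : Prop :=
  ∀ m : ℕ, Integrable (fun x : ℝ => f x * (x : ℂ) ^ m) ∧
    (∫ x : ℝ, f x * (x : ℂ) ^ m) = 0

/-- Schwartz-type seminorm (valued in [0,∞]). -/
def schwartzSemi1 (k m : ℕ) (f : ℝ → ℂ) : ℝ≥0∞ :=
  ⨆ x : ℝ, ENNReal.ofReal ((1 + ‖x‖) ^ k * ‖iteratedFDeriv ℝ m f x‖)

/-- Convergence in the topology of the Schwartz space on ℝ, along a filter `l`. -/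
def TendstoSchwartz1 {ι : Type*} (l : Filter ι) (F : ι → ℝ → ℂ) (f : ℝ → ℂ) : Prop :=
  ∀ k m : ℕ, Tendsto (fun N => schwartzSemi1 k m (fun x => F N x - f x)) l (nhds 0)

namespace SchwartzMap

/-- The reflected conjugate `x ↦ conj (u (-x))` of a Schwartz function. -/
def reflConj (u : 𝓢(ℝ, ℂ)) : 𝓢(ℝ, ℂ) :=
  (compCLMOfContinuousLinearEquiv ℝ (ContinuousLinearEquiv.neg ℝ) u).postcompCLM
    (Complex.conjCLE : ℂ →L[ℝ] ℂ)

theorem coe_reflConj (u : 𝓢(ℝ, ℂ)) : ⇑(reflConj u) = starF1 u := rfl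

/-- The `L¹`-normalized dilation `x ↦ t u(t x)` of a Schwartz function. -/
def dilate (t : ℝˣ) (u : 𝓢(ℝ, ℂ)) : 𝓢(ℝ, ℂ) :=
  (t : ℝ) • compCLMOfContinuousLinearEquiv ℝ (ContinuousLinearEquiv.unitsEquivAut ℝ t) u

theorem coe_dilate (t : ℝˣ) (u : 𝓢(ℝ, ℂ)) : ⇑(dilate t u) = dil1 t u := by
  ext x
  simp [dilate, dil1, mul_comm]

/-- The convolution of two complex-valued Schwartz functions. -/
def conv (u v : 𝓢(ℝ, ℂ)) : 𝓢(ℝ, ℂ) := convolution (ContinuousLinearMap.mul ℂ ℂ) u v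

theorem coe_conv (u v : 𝓢(ℝ, ℂ)) : ⇑(conv u v) = conv1 u v := by
  ext x
  rw [conv, convolution_apply]
  rfl

theorem fourier_conv_apply (u v : 𝓢(ℝ, ℂ)) (ξ : ℝ) : 𝓕 (conv u v) ξ = 𝓕 u ξ * 𝓕 v ξ := by
  simp [conv, fourier_convolution]

theorem fourier_reflConj_apply (u : 𝓢(ℝ, ℂ)) (ξ : ℝ) :
    𝓕 (reflConj u) ξ = starRingEnd ℂ (𝓕 u ξ) := by
  rw [fourier_coe, fourier_coe, coe_reflConj, Real.fourier_real_eq, Real.fourier_real_eq,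
    ← integral_conj, ← integral_neg_eq_self]
  congr 1 with x
  simp [starF1, Circle.smul_def, ← Circle.coe_inv_eq_conj, ← AddChar.map_neg_eq_inv]

theorem fourier_dilate_apply (t : ℝˣ) (ht : 0 < (t : ℝ)) (u : 𝓢(ℝ, ℂ)) (ξ : ℝ) :
    𝓕 (dilate t u) ξ = 𝓕 u ((t : ℝ)⁻¹ * ξ) := by
  rw [fourier_coe, fourier_coe, coe_dilate, Real.fourier_real_eq, Real.fourier_real_eq]
  have h := Measure.integral_comp_mul_left
    (fun x : ℝ => Real.fourierChar (-(x * ((t : ℝ)⁻¹ * ξ))) • u x) t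
  rw [abs_of_pos (inv_pos.2 ht), eq_inv_smul_iff₀ ht.ne', ← integral_smul] at h
  rw [← h]
  congr 1 with x
  rw [dil1, smul_comm]
  congr 4
  field_simp

theorem hasSum_of_summable_seminorm {ι : Type*} {G : ι → 𝓢(ℝ, ℂ)} {g : 𝓢(ℝ, ℂ)}
    (hG : ∀ k n : ℕ, Summable fun i => SchwartzMap.seminorm ℝ k n (G i))
    (hg : ∀ x, HasSum (fun i => G i x) (g x)) : HasSum G g := by
  have hgs : ⇑g = fun x => ∑' i, G i x := funext fun x => (hg x).tsum_eq.symm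
  have hderiv : ∀ n x, HasSum (fun i => iteratedFDeriv ℝ n (G i) x) (iteratedFDeriv ℝ n g x) := by
    intro n x
    have h := iteratedFDeriv_tsum_apply (𝕜 := ℝ) (N := ⊤) (f := fun i => ⇑(G i))
      (v := fun n i => SchwartzMap.seminorm ℝ 0 n (G i)) (fun i => (G i).smooth ⊤)
      (fun n _ => hG 0 n) (fun n i x _ => norm_iteratedFDeriv_le_seminorm ℝ (G i) n x)
      (k := n) le_top x
    rw [hgs, h]
    exact (Summable.of_norm_bounded (hG 0 n)
      fun i => norm_iteratedFDeriv_le_seminorm ℝ (G i) n x).hasSum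
  have hbound : ∀ (k n : ℕ) (s : Finset ι), SchwartzMap.seminorm ℝ k n (∑ i ∈ s, G i - g) ≤
      ∑' i : {i // i ∉ s}, SchwartzMap.seminorm ℝ k n (G i) := by
    intro k n s
    refine seminorm_le_bound ℝ k n _ (tsum_nonneg fun i => apply_nonneg _ _) fun x => ?_
    have hsum : iteratedFDeriv ℝ n (⇑(∑ i ∈ s, G i - g)) x =
        ∑ i ∈ s, iteratedFDeriv ℝ n (G i) x - iteratedFDeriv ℝ n g x := by
      have h1 : ⇑(∑ i ∈ s, G i - g) = (fun x => ∑ i ∈ s, G i x) - ⇑g := by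
        ext x
        simp
      have h2 : ContDiff ℝ n fun x => ∑ i ∈ s, G i x := ContDiff.sum fun i _ => (G i).smooth n
      rw [h1, iteratedFDeriv_sub h2 (g.smooth n), Pi.sub_apply,
        iteratedFDeriv_fun_sum_apply (fun i _ => ((G i).smooth n).contDiffAt)]
    have hsplit := (hderiv n x).summable.sum_add_tsum_compl (s := s)
    rw [(hderiv n x).tsum_eq] at hsplit
    have hs : Summable fun i : {i // i ∉ s} => SchwartzMap.seminorm ℝ k n (G i) :=
      (hG k n).subtype _
    rw [hsum, ← hsplit, sub_add_cancel_left, norm_neg, ← Real.norm_of_nonneg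
      (pow_nonneg (norm_nonneg x) k), ← norm_smul, ← tsum_const_smul'']
    refine tsum_of_norm_bounded hs.hasSum fun i => ?_
    rw [norm_smul, Real.norm_of_nonneg (pow_nonneg (norm_nonneg x) k)]
    exact le_seminorm ℝ k n (G i) x
  rw [HasSum, SummationFilter.unconditional_filter,
    (schwartz_withSeminorms ℝ ℝ ℂ).tendsto_nhds]
  rintro ⟨k, n⟩ ε hε
  filter_upwards [(tendsto_order.1
    (tendsto_tsum_compl_atTop_zero fun i => SchwartzMap.seminorm ℝ k n (G i))).2 ε hε] with s hs
  exact (hbound k n s).trans_lt hs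

/-- A Schwartz function all of whose derivatives vanish at the origin has derivatives decaying
to infinite order there. -/
theorem norm_iteratedDeriv_le_pow {u : 𝓢(ℝ, ℂ)} (hu : ∀ i, iteratedDeriv i u 0 = 0) (m : ℕ) :
    ∀ i, ∃ C, 0 ≤ C ∧ ∀ x, ‖iteratedDeriv i u x‖ ≤ C * |x| ^ m := by
  induction m with
  | zero =>
    intro i
    refine ⟨SchwartzMap.seminorm ℝ 0 i u, apply_nonneg _ _, fun x => ?_⟩
    simpa using le_seminorm' ℝ 0 i u x
  | succ m ih =>
    intro i
    obtain ⟨C, hC, h⟩ := ih (i + 1)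
    refine ⟨C, hC, fun x => ?_⟩
    have hd : Differentiable ℝ (iteratedDeriv i u) :=
      (u.smooth ⊤).differentiable_iteratedDeriv i (by exact_mod_cast WithTop.coe_lt_top _)
    have := (convex_uIcc (0 : ℝ) x).norm_image_sub_le_of_norm_deriv_le
      (f := iteratedDeriv i u) (C := C * |x| ^ m) (fun y _ => hd y)
      (fun y hy => by
        rw [← iteratedDeriv_succ]
        refine (h y).trans ?_
        have hyx : |y| ≤ |x| := by simpa using Set.abs_sub_left_of_mem_uIcc hy
        gcongr)
      Set.left_mem_uIcc Set.right_mem_uIcc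
    simpa [hu, pow_succ, mul_assoc] using this

theorem pow_mul_norm_iteratedDeriv_le_pow {u : 𝓢(ℝ, ℂ)} (hu : ∀ i, iteratedDeriv i u 0 = 0)
    (k m i : ℕ) : ∃ C, 0 ≤ C ∧ ∀ x, |x| ^ k * ‖iteratedDeriv i u x‖ ≤ C * |x| ^ m := by
  obtain ⟨C, hC, h⟩ := norm_iteratedDeriv_le_pow hu m i
  have hp : 0 ≤ SchwartzMap.seminorm ℝ k i u := apply_nonneg _ _
  refine ⟨C + SchwartzMap.seminorm ℝ k i u, add_nonneg hC hp, fun x => ?_⟩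
  have hm : 0 ≤ |x| ^ m := by positivity
  rw [add_mul]
  rcases le_total |x| 1 with hx | hx
  · have h1 : |x| ^ k * ‖iteratedDeriv i u x‖ ≤ ‖iteratedDeriv i u x‖ :=
      mul_le_of_le_one_left (norm_nonneg _) (pow_le_one₀ (abs_nonneg x) hx)
    linarith [h x, mul_nonneg hp hm]
  · have h1 := le_mul_of_one_le_right hp (one_le_pow₀ hx (n := m))
    linarith [le_seminorm' ℝ k i u x, mul_nonneg hC hm]

theorem pow_mul_norm_iteratedDeriv_mul_dilation_le {g h : 𝓢(ℝ, ℂ)}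
    (hg : ∀ i, iteratedDeriv i g 0 = 0) (hh : ∀ i, iteratedDeriv i h 0 = 0) (k i l : ℕ) :
    ∃ C, 0 ≤ C ∧ ∀ c : ℝ, 0 < c → ∀ x,
      |x| ^ k * (‖iteratedDeriv i g x‖ * (c ^ l * ‖iteratedDeriv l h (c * x)‖)) ≤
        C * min c c⁻¹ := by
  obtain ⟨A, hA, hhA⟩ := norm_iteratedDeriv_le_pow hh 1 l
  obtain ⟨B, hB, hgB⟩ := pow_mul_norm_iteratedDeriv_le_pow hg k (l + 1) i
  have hP : 0 ≤ SchwartzMap.seminorm ℝ (k + 1) i g := apply_nonneg _ _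
  have hQ : 0 ≤ SchwartzMap.seminorm ℝ (l + 1) l h := apply_nonneg _ _
  refine ⟨SchwartzMap.seminorm ℝ (k + 1) i g * A + B * SchwartzMap.seminorm ℝ (l + 1) l h,
    by positivity, fun c hc x => ?_⟩
  rcases le_total c 1 with hc1 | hc1
  · rw [min_eq_left (hc1.trans ((one_le_inv₀ hc).2 hc1))]
    calc |x| ^ k * (‖iteratedDeriv i g x‖ * (c ^ l * ‖iteratedDeriv l h (c * x)‖))
        ≤ |x| ^ k * (‖iteratedDeriv i g x‖ * (1 * (A * |c * x| ^ 1))) := by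
          gcongr
          · exact pow_le_one₀ hc.le hc1
          · exact hhA _
      _ = (|x| ^ (k + 1) * ‖iteratedDeriv i g x‖) * A * c := by
          rw [abs_mul, abs_of_pos hc]
          ring
      _ ≤ SchwartzMap.seminorm ℝ (k + 1) i g * A * c := by
          gcongr
          exact le_seminorm' ℝ _ _ g x
      _ ≤ _ := by
          gcongr
          exact le_add_of_nonneg_right (by positivity)
  · rw [min_eq_right ((inv_le_one_of_one_le₀ hc1).trans hc1)]
    calc |x| ^ k * (‖iteratedDeriv i g x‖ * (c ^ l * ‖iteratedDeriv l h (c * x)‖))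
        = (|x| ^ k * ‖iteratedDeriv i g x‖) * (c ^ l * ‖iteratedDeriv l h (c * x)‖) := by ring
      _ ≤ (B * |x| ^ (l + 1)) * (c ^ l * ‖iteratedDeriv l h (c * x)‖) := by
          exact mul_le_mul_of_nonneg_right (hgB x) (by positivity)
      _ = B * (|c * x| ^ (l + 1) * ‖iteratedDeriv l h (c * x)‖) * c⁻¹ := by
          rw [abs_mul, abs_of_pos hc]
          field_simp
          ring
      _ ≤ B * SchwartzMap.seminorm ℝ (l + 1) l h * c⁻¹ := by
          gcongr
          exact le_seminorm' ℝ _ _ h _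
      _ ≤ _ := by
          gcongr
          exact le_add_of_nonneg_left (by positivity)

theorem seminorm_mul_dilation_le {g h : 𝓢(ℝ, ℂ)} (hg : ∀ i, iteratedDeriv i g 0 = 0)
    (hh : ∀ i, iteratedDeriv i h 0 = 0) (k n : ℕ) :
    ∃ C, 0 ≤ C ∧ ∀ c : ℝ, 0 < c → ∀ G : 𝓢(ℝ, ℂ), (∀ x, G x = g x * h (c * x)) →
      SchwartzMap.seminorm ℝ k n G ≤ C * min c c⁻¹ := by
  choose C hC0 hC using fun i => pow_mul_norm_iteratedDeriv_mul_dilation_le hg hh k i (n - i)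
  refine ⟨∑ i ∈ Finset.range (n + 1), n.choose i * C i,
    Finset.sum_nonneg fun i _ => mul_nonneg (by positivity) (hC0 i), fun c hc G hG => ?_⟩
  have hmin : 0 < min c c⁻¹ := lt_min hc (inv_pos.2 hc)
  refine seminorm_le_bound' ℝ k n G (mul_nonneg
    (Finset.sum_nonneg fun i _ => mul_nonneg (by positivity) (hC0 i)) hmin.le) fun x => ?_
  have hGf : ⇑G = ⇑g * fun x => h (c * x) := funext hG
  have hdil : ContDiff ℝ n fun x => h (c * x) :=
    (h.smooth n).comp (contDiff_const.mul contDiff_id)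
  rw [hGf, iteratedDeriv_mul (g.smooth n).contDiffAt hdil.contDiffAt]
  refine (mul_le_mul_of_nonneg_left (norm_sum_le _ _) (by positivity)).trans ?_
  rw [Finset.mul_sum, Finset.sum_mul]
  refine Finset.sum_le_sum fun i _ => ?_
  rw [iteratedDeriv_comp_const_smul (h.smooth _) c, norm_mul, norm_mul, norm_smul, norm_pow,
    Real.norm_of_nonneg hc.le, Complex.norm_natCast]
  calc _ = n.choose i *
        (|x| ^ k * (‖iteratedDeriv i g x‖ * (c ^ (n - i) * ‖iteratedDeriv (n - i) h (c * x)‖))) := by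
        ring
    _ ≤ n.choose i * (C i * min c c⁻¹) := by
        exact mul_le_mul_of_nonneg_left (hC i c hc x) (Nat.cast_nonneg _)
    _ = _ := by ring

theorem summable_min_two_zpow :
    Summable fun j : ℤ => min (((2 : ℝ) ^ j)⁻¹) (((2 : ℝ) ^ j)⁻¹)⁻¹ := by
  refine Summable.of_nat_of_neg ?_ ?_
  all_goals
    refine Summable.of_nonneg_of_le (fun n => by positivity) (fun n => ?_)
      (summable_geometric_of_lt_one (r := (2 : ℝ)⁻¹) (by norm_num) (by norm_num))
    simp

/-- Littlewood–Paley decomposition on the Fourier side. -/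
theorem hasSum_mul_dilation {g h : 𝓢(ℝ, ℂ)} (hg : ∀ i, iteratedDeriv i g 0 = 0)
    (hh : ∀ i, iteratedDeriv i h 0 = 0)
    (hsum : ∀ ξ : ℝ, ξ ≠ 0 → HasSum (fun j : ℤ => h (((2 : ℝ) ^ j)⁻¹ * ξ)) 1)
    {G : ℤ → 𝓢(ℝ, ℂ)} (hG : ∀ j ξ, G j ξ = g ξ * h (((2 : ℝ) ^ j)⁻¹ * ξ)) : HasSum G g := by
  refine hasSum_of_summable_seminorm (fun k n => ?_) fun ξ => ?_
  · obtain ⟨C, -, hC⟩ := seminorm_mul_dilation_le hg hh k n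
    exact Summable.of_nonneg_of_le (fun j => apply_nonneg _ _)
      (fun j => hC _ (by positivity) _ (hG j)) (summable_min_two_zpow.mul_left C)
  · simp only [hG]
    by_cases hξ : ξ = 0
    · have h0 : g 0 = 0 := by simpa using hg 0
      simp [hξ, h0, hasSum_zero]
    · simpa using (hsum ξ hξ).mul_left (g ξ)

theorem iteratedDeriv_fourier_zero_of_allMomentsVanish {f : 𝓢(ℝ, ℂ)}
    (hf : AllMomentsVanish1 f) (i : ℕ) : iteratedDeriv i (⇑(𝓕 f : 𝓢(ℝ, ℂ))) 0 = 0 := by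
  rw [fourier_coe, Real.iteratedDeriv_fourier (N := ⊤) (fun n _ => ?_) le_top]
  · rw [Real.fourier_real_eq]
    have h := congrArg ((-2 * (Real.pi : ℂ) * Complex.I) ^ i * ·) (hf i).2
    simp only [mul_zero, ← integral_const_mul] at h
    rw [← h]
    congr 1 with x
    simp
    ring
  · rw [← integrable_norm_iff (by fun_prop)]
    simpa [norm_smul] using f.integrable_pow_mul volume n

theorem tendstoSchwartz1_of_tendsto {ι : Type*} {l : Filter ι} {F : ι → 𝓢(ℝ, ℂ)} {f : 𝓢(ℝ, ℂ)}
    (h : Tendsto F l (𝓝 f)) : TendstoSchwartz1 l (fun i => ⇑(F i)) f := by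
  intro k m
  rw [(schwartz_withSeminorms ℝ ℝ ℂ).tendsto_nhds'] at h
  refine ENNReal.tendsto_nhds_zero.2 fun ε hε => ?_
  obtain ⟨r, hr, hrε⟩ : ∃ r : ℝ, 0 < r ∧ ENNReal.ofReal r ≤ ε := by
    obtain ⟨r, hr, hrε⟩ := ENNReal.lt_iff_exists_nnreal_btwn.1 hε
    exact ⟨r, by simpa using hr, by simpa using hrε.le⟩
  filter_upwards [h (Finset.Iic (k, m)) (r / 2 ^ k) (by positivity)] with i hi
  refine iSup_le fun x => (ENNReal.ofReal_le_ofReal ?_).trans hrε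
  refine (one_add_le_sup_seminorm_apply (𝕜 := ℝ) (m := (k, m)) le_rfl le_rfl (F i - f) x).trans ?_
  rw [mul_comm]
  exact ((lt_div_iff₀ (by positivity)).1 hi).le

end SchwartzMap

/-- The Remark after Lemma 3.6 of the paper, for G = ℝ: with ψ as in Lemma 3.6 (with ψ̂
vanishing on (−δ, δ)) and φ a Schwartz function with φ̂ supported in (−δ, δ) and
φ̂(0) ≠ 0, the function η = ψ + φ satisfies η^* ∗ ψ = ψ^* ∗ ψ, the pair (η, ψ) is
LP-admissible, and yet the zeroth moment ∫ η = φ̂(0) of η is nonzero. -/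
theorem statement8 (ψ φ : 𝓢(ℝ, ℂ)) (δ : ℝ) (hδ : 0 < δ)
    (hψ_smooth : ContDiff ℝ ∞ (𝓕 ⇑ψ))
    (hψ_supp : HasCompactSupport (𝓕 ⇑ψ))
    (hψ_near0 : ∀ ξ ∈ Set.Ioo (-δ) δ, 𝓕 (⇑ψ) ξ = 0)
    (hψ_part : ∀ ξ : ℝ, ξ ≠ 0 → ∑' j : ℤ, ‖𝓕 (⇑ψ) ((2:ℝ) ^ j * ξ)‖ ^ 2 = 1)
    (hφ_supp : ∀ ξ : ℝ, ξ ∉ Set.Ioo (-δ) δ → 𝓕 (⇑φ) ξ = 0)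
    (hφ0 : 𝓕 (⇑φ) 0 ≠ 0) :
    (∀ x : ℝ, conv1 (starF1 (⇑ψ + ⇑φ)) (⇑ψ) x = conv1 (starF1 (⇑ψ)) (⇑ψ) x) ∧
    (∀ f : 𝓢(ℝ, ℂ), AllMomentsVanish1 (⇑f) →
      TendstoSchwartz1 atTop
        (fun N : ℕ => fun x => ∑ j ∈ Finset.Icc (-(N : ℤ)) (N : ℤ),
          conv1 (conv1 (⇑f) (starF1 (dil1 ((2:ℝ) ^ j) (⇑ψ + ⇑φ))))
            (dil1 ((2:ℝ) ^ j) (⇑ψ)) x)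
        (⇑f)) ∧
    (∫ x : ℝ, (ψ x + φ x)) = 𝓕 (⇑φ) 0 ∧ (∫ x : ℝ, (ψ x + φ x)) ≠ 0 := by
  have hprod : ∀ ξ, starRingEnd ℂ (𝓕 (ψ + φ) ξ) * 𝓕 ψ ξ = starRingEnd ℂ (𝓕 ψ ξ) * 𝓕 ψ ξ := by
    intro ξ
    rw [FourierTransform.fourier_add, add_apply, map_add, add_mul, add_eq_left, fourier_coe φ,
      fourier_coe ψ]
    by_cases hξ : ξ ∈ Set.Ioo (-δ) δ
    · rw [hψ_near0 ξ hξ, mul_zero]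
    · rw [hφ_supp ξ hξ, map_zero, zero_mul]
  have hconv : conv (reflConj (ψ + φ)) ψ = conv (reflConj ψ) ψ := by
    refine (FourierTransform.fourierEquiv ℂ 𝓢(ℝ, ℂ)).injective ?_
    simp only [FourierTransform.fourierEquiv_apply]
    ext ξ
    simp only [fourier_conv_apply, fourier_reflConj_apply, hprod]
  have hint : ∫ x : ℝ, (ψ x + φ x) = 𝓕 (⇑φ) 0 := by
    have h0 := hψ_near0 0 ⟨by linarith, hδ⟩
    rw [Real.fourier_real_eq] at h0 ⊢
    simp only [mul_zero, neg_zero, AddChar.map_zero_eq_one, one_smul] at h0 ⊢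
    rw [integral_add ψ.integrable φ.integrable, h0, zero_add]
  refine ⟨fun x => ?_, fun f hf => ?_, hint, hint ▸ hφ0⟩
  · have h := congrArg (fun u : 𝓢(ℝ, ℂ) => u x) hconv
    simpa only [coe_conv, coe_reflConj, FunLike.coe_add] using h
  let t : ℤ → ℝˣ := fun j => Units.mk0 ((2 : ℝ) ^ j) (by positivity)
  let F : ℤ → 𝓢(ℝ, ℂ) := fun j =>
    conv (conv f (reflConj (dilate (t j) (ψ + φ)))) (dilate (t j) ψ)
  set h : 𝓢(ℝ, ℂ) := 𝓕 (conv (reflConj ψ) ψ) with hh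
  have hh_apply : ∀ ξ, h ξ = ((‖𝓕 (⇑ψ) ξ‖ ^ 2 : ℝ) : ℂ) := by
    intro ξ
    rw [hh, fourier_conv_apply, fourier_reflConj_apply, Complex.conj_mul', fourier_coe]
    push_cast
    rfl
  have hflat : ∀ i, iteratedDeriv i h 0 = 0 := by
    intro i
    have hev : ⇑h =ᶠ[𝓝 0] fun _ => 0 := by
      filter_upwards [Ioo_mem_nhds (neg_lt_zero.2 hδ) hδ] with ξ hξ
      rw [hh_apply, hψ_near0 ξ hξ]
      simp
    rw [hev.iteratedDeriv_eq]
    simp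
  have hone : ∀ ξ : ℝ, ξ ≠ 0 → HasSum (fun j : ℤ => h (((2 : ℝ) ^ j)⁻¹ * ξ)) 1 := by
    intro ξ hξ
    have hs : HasSum (fun j : ℤ => ‖𝓕 (⇑ψ) ((2:ℝ) ^ j * ξ)‖ ^ 2) 1 := by
      rw [← hψ_part ξ hξ]
      refine Summable.hasSum (by_contra fun hns => ?_)
      exact zero_ne_one ((tsum_eq_zero_of_not_summable hns).symm.trans (hψ_part ξ hξ))
    have hs' := (Equiv.neg ℤ).hasSum_iff.2 (Complex.hasSum_ofReal.2 hs)
    simpa [Function.comp_def, hh_apply, zpow_neg] using hs'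
  have hF : ∀ j ξ, 𝓕 (F j) ξ = 𝓕 f ξ * h (((2 : ℝ) ^ j)⁻¹ * ξ) := by
    intro j ξ
    have ht : 0 < (t j : ℝ) := by simp only [t, Units.val_mk0]; positivity
    simp only [F, fourier_conv_apply, fourier_reflConj_apply, fourier_dilate_apply _ ht, mul_assoc,
      hprod, hh]
    rfl
  have hsum := hasSum_mul_dilation (iteratedDeriv_fourier_zero_of_allMomentsVanish hf) hflat hone hF
  have hsumF : HasSum F f := by
    simpa [Function.comp_def] using
      hsum.mapL (FourierTransform.fourierInvCLM ℂ 𝓢(ℝ, ℂ))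
  have htend : Tendsto (fun N : ℕ => ∑ j ∈ Finset.Icc (-(N : ℤ)) N, F j) atTop (𝓝 f) :=
    hsumF.comp (Finset.tendsto_Icc_neg.comp tendsto_natCast_atTop_atTop)
  convert! tendstoSchwartz1_of_tendsto htend using 2 with N
  ext x
  simp [F, coe_conv, coe_reflConj, coe_dilate, t]

end
end
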